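/- arXiv:2512.20658 — 4 statements merged into one kernel-verified Lean document; each statement's English description precedes it below -/
import Mathlib

section
/- Let m > 0, σ ∈ 𝒜(m), φ(x) = σ(x + m) − σ(x − m), let a < b be reals, n ≥ 1 an integer, h = (b − a)/n and x_k = a + k·h for k = 0, …, n. Then for all j, k ∈ {0, 1, …, n}, φ((2m/h)(x_k − x_j)) equals 1 if j = k and equals 0 if j ≠ k; consequently, for every function g : [a,b] → ℝ, S_{n,σ}(g, x_k) = g(x_k) for every k = 0, 1, …, n. -/
/-- `phi σ m x = σ(x+m) - σ(x-m)`. -/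
noncomputable def phi (σ : ℝ → ℝ) (m : ℝ) (x : ℝ) : ℝ := σ (x + m) - σ (x - m)

/-- The node `x_k = a + k·h` with `h = (b-a)/n`. -/
noncomputable def node (a b : ℝ) (n : ℕ) (k : ℕ) : ℝ := a + k * ((b - a) / n)

/-- The Cardaliaguet–Euvrard neural network operator
`S_{n,σ}(g, x) = ∑_{k=0}^{n} φ((2m/h)(x − x_k)) · g(x_k)`. -/
noncomputable def NN (σ : ℝ → ℝ) (m a b : ℝ) (n : ℕ) (g : ℝ → ℝ) (x : ℝ) : ℝ :=
  ∑ k ∈ Finset.range (n + 1),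
    phi σ m (2 * m / ((b - a) / n) * (x - node a b n k)) * g (node a b n k)

theorem phi_two_mul_int_mul {m : ℝ} (hm : 0 < m) {σ : ℝ → ℝ}
    (hσ0 : ∀ x : ℝ, x ≤ -m → σ x = 0) (hσ1 : ∀ x : ℝ, m ≤ x → σ x = 1) (d : ℤ) :
    phi σ m (2 * m * d) = if d = 0 then 1 else 0 := by
  unfold phi
  rcases lt_trichotomy d 0 with hd | rfl | hd
  · have h : (d : ℝ) ≤ -1 := by exact_mod_cast Int.le_sub_one_of_lt hd
    rw [hσ0 _ (by nlinarith), hσ0 _ (by nlinarith), if_neg hd.ne, sub_zero]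
  · rw [hσ1 _ (by simp), hσ0 _ (by simp), if_pos rfl, sub_zero]
  · have h : (1 : ℝ) ≤ d := by exact_mod_cast hd
    rw [hσ1 _ (by nlinarith), hσ1 _ (by nlinarith), if_neg hd.ne', sub_self]

theorem scaled_node_sub_node (m : ℝ) {a b : ℝ} (hab : a < b) {n : ℕ} (hn : 1 ≤ n) (j k : ℕ) :
    2 * m / ((b - a) / n) * (node a b n k - node a b n j) = 2 * m * ((k - j : ℤ) : ℝ) := by
  have hh : (b - a) / n ≠ 0 :=
    div_ne_zero (sub_ne_zero.mpr hab.ne') (Nat.cast_ne_zero.mpr (by omega))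
  unfold node
  generalize (b - a) / n = h at hh
  push_cast
  field_simp
  ring

/-- Interpolation property: `φ((2m/h)(x_k − x_j))` is `1` if `j = k` and `0` otherwise, and
consequently `S_{n,σ}(g, x_k) = g(x_k)` for every node `x_k`. -/
theorem stmt2 (m : ℝ) (hm : 0 < m) (σ : ℝ → ℝ)
    (hσ_mono : Monotone σ)
    (hσ0 : ∀ x : ℝ, x ≤ -m → σ x = 0)
    (hσ1 : ∀ x : ℝ, m ≤ x → σ x = 1)
    (a b : ℝ) (hab : a < b) (n : ℕ) (hn : 1 ≤ n) (g : ℝ → ℝ) :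
    (∀ j k : ℕ, j ≤ n → k ≤ n →
      phi σ m (2 * m / ((b - a) / n) * (node a b n k - node a b n j)) =
        if j = k then 1 else 0) ∧
    (∀ k : ℕ, k ≤ n → NN σ m a b n g (node a b n k) = g (node a b n k)) := by
  have key : ∀ j k : ℕ, phi σ m (2 * m / ((b - a) / n) * (node a b n k - node a b n j)) =
      if j = k then 1 else 0 := by
    intro j k
    rw [scaled_node_sub_node m hab hn, phi_two_mul_int_mul hm hσ0 hσ1]
    exact if_congr (by omega) rfl rfl
  refine ⟨fun j k _ _ => key j k, fun k hk => ?_⟩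
  simp [NN, key, Nat.lt_succ_of_le hk]
end

section
/- Let m > 0, σ ∈ 𝒜(m), φ(x) = σ(x + m) − σ(x − m), let a < b be reals, n ≥ 1 an integer, h = (b − a)/n and x_k = a + k·h for k = 0, …, n. Then for every x ∈ [a, b], ∑_{j=0}^{n} φ((2m/h)(x − x_j)) = 1. -/
/-- Sums of `phi` over translates by multiples of `2m` telescope. -/
theorem sum_range_phi_sub_mul (σ : ℝ → ℝ) (m u : ℝ) (n : ℕ) :
    ∑ j ∈ Finset.range n, phi σ m (u - 2 * m * j) = σ (u + m) - σ (u - 2 * m * n + m) := by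
  have h := Finset.sum_range_sub' (fun j : ℕ => σ (u - 2 * m * j + m)) n
  simp only [Nat.cast_zero, mul_zero, sub_zero] at h
  rw [← h]
  refine Finset.sum_congr rfl fun j _ => ?_
  rw [phi, show u - 2 * m * (j + 1 : ℕ) + m = u - 2 * m * j - m by push_cast; ring]

/-- Partition of unity: for every `x ∈ [a,b]`, `∑_{j=0}^{n} φ((2m/h)(x − x_j)) = 1`. -/
theorem stmt3 (m : ℝ) (hm : 0 < m) (σ : ℝ → ℝ)
    (hσ_mono : Monotone σ)
    (hσ0 : ∀ x : ℝ, x ≤ -m → σ x = 0)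
    (hσ1 : ∀ x : ℝ, m ≤ x → σ x = 1)
    (a b : ℝ) (hab : a < b) (n : ℕ) (hn : 1 ≤ n) :
    ∀ x ∈ Set.Icc a b,
      ∑ j ∈ Finset.range (n + 1),
        phi σ m (2 * m / ((b - a) / n) * (x - node a b n j)) = 1 := by
  rintro x ⟨hax, hxb⟩
  have hn' : (0 : ℝ) < n := by exact_mod_cast hn
  set h := (b - a) / n with h_def
  have hh : 0 < h := div_pos (sub_pos.mpr hab) hn'
  set u := 2 * m / h * (x - a) with hu
  have hc : 0 < 2 * m / h := by positivity
  have hu0 : 0 ≤ u := mul_nonneg hc.le (sub_nonneg.mpr hax)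
  have hun : u ≤ 2 * m * n :=
    calc u ≤ 2 * m / h * (b - a) := by rw [hu]; gcongr
      _ = 2 * m / h * (n * h) := by rw [h_def, mul_div_cancel₀ _ hn'.ne']
      _ = 2 * m * n := by field_simp
  have hterm (j : ℕ) : 2 * m / h * (x - node a b n j) = u - 2 * m * j := by
    rw [node, ← h_def, hu]
    field_simp
    ring
  simp only [hterm]
  rw [sum_range_phi_sub_mul, hσ1 _ (by linarith), hσ0 _ (by push_cast; linarith), sub_zero]
end

section
/- (Levelwise Jackson estimate for level continuous functions.) Let m > 0, σ ∈ 𝒜(m), let a < b be reals, n ≥ 1 an integer, h = (b − a)/n, and let g⁻, g⁺ : [a,b] → ℝ satisfy g⁻(t) ≤ g⁺(t) for all t ∈ [a,b]. If ε ≥ 0 is such that d_H([g⁻(s), g⁺(s)], [g⁻(t), g⁺(t)]) ≤ ε for all s, t ∈ [a,b] with |s − t| < h, then for every x ∈ [a, b], d_H([S_{n,σ}(g⁻, x), S_{n,σ}(g⁺, x)], [g⁻(x), g⁺(x)]) ≤ ε, where [·,·] denotes a closed interval in ℝ and d_H the Hausdorff distance between subsets of ℝ. -/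
/-- Compact intervals with `ε`-close endpoints are at Hausdorff distance at most `ε`. -/
lemma hausdorffDist_Icc_le {p q r s ε : ℝ} (hpq : p ≤ q) (hrs : r ≤ s)
    (hpr : |p - r| ≤ ε) (hqs : |q - s| ≤ ε) :
    Metric.hausdorffDist (Set.Icc p q) (Set.Icc r s) ≤ ε := by
  have exists_near : ∀ {p q r s : ℝ}, r ≤ s → |p - r| ≤ ε → |q - s| ≤ ε →
      ∀ z ∈ Set.Icc p q, ∃ y ∈ Set.Icc r s, dist z y ≤ ε := by
    rintro p q r s hrs hpr hqs z ⟨hpz, hzq⟩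
    rw [abs_le] at hpr hqs
    rcases le_total z r with hzr | hrz
    · exact ⟨r, ⟨le_rfl, hrs⟩, by rw [Real.dist_eq, abs_le]; constructor <;> linarith⟩
    rcases le_total z s with hzs | hsz
    · exact ⟨z, ⟨hrz, hzs⟩, by rw [dist_self]; linarith⟩
    · exact ⟨s, ⟨hrs, le_rfl⟩, by rw [Real.dist_eq, abs_le]; constructor <;> linarith⟩
  refine Metric.hausdorffDist_le_of_mem_dist ((abs_nonneg _).trans hpr)
    (exists_near hrs hpr hqs) (exists_near hpq ?_ ?_)
  · rwa [abs_sub_comm]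
  · rwa [abs_sub_comm]

/-- The endpoints of compact intervals are as close as the intervals are in Hausdorff distance. -/
lemma abs_sub_le_of_hausdorffDist_Icc_le {p q r s ε : ℝ} (hpq : p ≤ q) (hrs : r ≤ s)
    (h : Metric.hausdorffDist (Set.Icc p q) (Set.Icc r s) ≤ ε) :
    |p - r| ≤ ε ∧ |q - s| ≤ ε := by
  have hfin : Metric.hausdorffEDist (Set.Icc p q) (Set.Icc r s) ≠ ⊤ :=
    Metric.hausdorffEDist_ne_top_of_nonempty_of_bounded (Set.nonempty_Icc.2 hpq)
      (Set.nonempty_Icc.2 hrs) (Metric.isBounded_Icc p q) (Metric.isBounded_Icc r s)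
  have near_left : ∀ z ∈ Set.Icc p q, r - ε ≤ z ∧ z ≤ s + ε := by
    refine fun z hz => ⟨le_of_forall_pos_le_add fun δ hδ => ?_,
      le_of_forall_pos_le_add fun δ hδ => ?_⟩ <;>
    · obtain ⟨y, hy, hzy⟩ := Metric.exists_dist_lt_of_hausdorffDist_lt hz
        (h.trans_lt (lt_add_of_pos_right ε hδ)) hfin
      rw [Real.dist_eq, abs_lt] at hzy
      linarith [hy.1, hy.2]
  have near_right : ∀ z ∈ Set.Icc r s, p - ε ≤ z ∧ z ≤ q + ε := by
    refine fun z hz => ⟨le_of_forall_pos_le_add fun δ hδ => ?_,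
      le_of_forall_pos_le_add fun δ hδ => ?_⟩ <;>
    · obtain ⟨y, hy, hzy⟩ := Metric.exists_dist_lt_of_hausdorffDist_lt' hz
        (h.trans_lt (lt_add_of_pos_right ε hδ)) hfin
      rw [Real.dist_eq, abs_lt] at hzy
      linarith [hy.1, hy.2]
  have hp := near_left p (Set.left_mem_Icc.2 hpq)
  have hq := near_left q (Set.right_mem_Icc.2 hpq)
  have hr := near_right r (Set.left_mem_Icc.2 hrs)
  have hs := near_right s (Set.right_mem_Icc.2 hrs)
  rw [abs_le, abs_le]
  refine ⟨⟨?_, ?_⟩, ?_, ?_⟩ <;> linarith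

lemma phi_nonneg {σ : ℝ → ℝ} (hσ : Monotone σ) {m : ℝ} (hm : 0 ≤ m) (x : ℝ) :
    0 ≤ phi σ m x :=
  sub_nonneg.2 (hσ (by linarith))

lemma phi_eq_zero_of_le_abs {σ : ℝ → ℝ} {m : ℝ} (hm : 0 ≤ m)
    (hσ0 : ∀ x : ℝ, x ≤ -m → σ x = 0) (hσ1 : ∀ x : ℝ, m ≤ x → σ x = 1)
    {x : ℝ} (hx : 2 * m ≤ |x|) : phi σ m x = 0 := by
  unfold phi
  rcases le_abs.1 hx with h | h
  · rw [hσ1 _ (by linarith), hσ1 _ (by linarith), sub_self]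
  · rw [hσ0 _ (by linarith), hσ0 _ (by linarith), sub_self]

lemma node_mem_Icc {a b : ℝ} (hab : a ≤ b) {n k : ℕ} (hn : 0 < n) (hk : k ≤ n) :
    node a b n k ∈ Set.Icc a b := by
  have hn' : (0 : ℝ) < n := by exact_mod_cast hn
  have hh : 0 ≤ (b - a) / n := div_nonneg (sub_nonneg.2 hab) hn'.le
  have hkn : (k : ℝ) * ((b - a) / n) ≤ n * ((b - a) / n) := by gcongr
  rw [mul_div_cancel₀ _ hn'.ne'] at hkn
  have hk0 : 0 ≤ (k : ℝ) * ((b - a) / n) := by positivity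
  unfold node
  constructor <;> linarith

/-- The shifted and scaled copies of `phi` form a partition of unity on `[a, b]`. -/
lemma sum_phi_eq_one {σ : ℝ → ℝ} {m : ℝ} (hm : 0 ≤ m)
    (hσ0 : ∀ x : ℝ, x ≤ -m → σ x = 0) (hσ1 : ∀ x : ℝ, m ≤ x → σ x = 1)
    {a b : ℝ} (hab : a < b) {n : ℕ} (hn : 0 < n) {x : ℝ} (hx : x ∈ Set.Icc a b) :
    ∑ k ∈ Finset.range (n + 1),
      phi σ m (2 * m / ((b - a) / n) * (x - node a b n k)) = 1 := by
  have hn' : (0 : ℝ) < n := by exact_mod_cast hn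
  have hba : 0 < b - a := sub_pos.2 hab
  have hh : 0 < (b - a) / n := by positivity
  set y := 2 * m / ((b - a) / n) * (x - a) with hy
  have hy0 : 0 ≤ y := mul_nonneg (by positivity) (sub_nonneg.2 hx.1)
  have hyn : y ≤ 2 * m * n := by
    calc y ≤ 2 * m / ((b - a) / n) * (b - a) := by
          rw [hy]; gcongr; exact hx.2
      _ = 2 * m * n := by field_simp
  have hterm : ∀ k ∈ Finset.range (n + 1),
      phi σ m (2 * m / ((b - a) / n) * (x - node a b n k)) =
        σ (y + m - 2 * m * k) - σ (y + m - 2 * m * (k + 1 : ℕ)) := by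
    intro k _
    have harg : 2 * m / ((b - a) / n) * (x - node a b n k) = y - 2 * m * k := by
      rw [hy, node]; field_simp; ring
    rw [harg, phi]
    push_cast
    congr 2 <;> ring
  rw [Finset.sum_congr rfl hterm,
    Finset.sum_range_sub' fun k : ℕ => σ (y + m - 2 * m * k)]
  push_cast
  rw [hσ1 _ (by linarith), hσ0 _ (by linarith), sub_zero]

/-- Pointwise Jackson estimate: only nodes within distance less than `h` of `x` contribute. -/
lemma abs_NN_sub_le {σ : ℝ → ℝ} (hσ : Monotone σ) {m : ℝ} (hm : 0 ≤ m)
    (hσ0 : ∀ x : ℝ, x ≤ -m → σ x = 0) (hσ1 : ∀ x : ℝ, m ≤ x → σ x = 1)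
    {a b : ℝ} (hab : a < b) {n : ℕ} (hn : 0 < n) {g : ℝ → ℝ} {x ε : ℝ}
    (hx : x ∈ Set.Icc a b)
    (hg : ∀ t ∈ Set.Icc a b, |t - x| < (b - a) / n → |g t - g x| ≤ ε) :
    |NN σ m a b n g x - g x| ≤ ε := by
  have hn' : (0 : ℝ) < n := by exact_mod_cast hn
  have hh : 0 < (b - a) / n := div_pos (sub_pos.2 hab) hn'
  set w : ℕ → ℝ := fun k => phi σ m (2 * m / ((b - a) / n) * (x - node a b n k))
  have hw1 : ∑ k ∈ Finset.range (n + 1), w k = 1 := sum_phi_eq_one hm hσ0 hσ1 hab hn hx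
  have hsub : NN σ m a b n g x - g x =
      ∑ k ∈ Finset.range (n + 1), w k * (g (node a b n k) - g x) := by
    simp_rw [mul_sub (w _), Finset.sum_sub_distrib, ← Finset.sum_mul, hw1, one_mul]
    rfl
  calc |NN σ m a b n g x - g x|
      ≤ ∑ k ∈ Finset.range (n + 1), |w k * (g (node a b n k) - g x)| := by
        rw [hsub]; exact Finset.abs_sum_le_sum_abs _ _
    _ ≤ ∑ k ∈ Finset.range (n + 1), w k * ε := by
        refine Finset.sum_le_sum fun k hk => ?_
        have hw0 : 0 ≤ w k := phi_nonneg hσ hm _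
        rw [abs_mul, abs_of_nonneg hw0]
        rcases lt_or_ge |node a b n k - x| ((b - a) / n) with hlt | hge
        · exact mul_le_mul_of_nonneg_left
            (hg _ (node_mem_Icc hab.le hn (Nat.lt_succ_iff.1 (Finset.mem_range.1 hk))) hlt) hw0
        · have hwk : w k = 0 := by
            refine phi_eq_zero_of_le_abs hm hσ0 hσ1 ?_
            rw [abs_mul, abs_of_nonneg (by positivity : 0 ≤ 2 * m / ((b - a) / n)), abs_sub_comm]
            calc 2 * m = 2 * m / ((b - a) / n) * ((b - a) / n) :=
                  (div_mul_cancel₀ _ hh.ne').symm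
              _ ≤ _ := by gcongr
          simp [hwk]
    _ = ε := by rw [← Finset.sum_mul, hw1, one_mul]

lemma NN_mono {σ : ℝ → ℝ} (hσ : Monotone σ) {m : ℝ} (hm : 0 ≤ m)
    {a b : ℝ} (hab : a ≤ b) {n : ℕ} (hn : 0 < n) {f g : ℝ → ℝ}
    (hfg : ∀ t ∈ Set.Icc a b, f t ≤ g t) (x : ℝ) :
    NN σ m a b n f x ≤ NN σ m a b n g x :=
  Finset.sum_le_sum fun _ hk => mul_le_mul_of_nonneg_left
    (hfg _ (node_mem_Icc hab hn (Nat.lt_succ_iff.1 (Finset.mem_range.1 hk)))) (phi_nonneg hσ hm _)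

/-- Levelwise Jackson estimate for level continuous functions: if the Hausdorff distance
between the λ-levels `[g⁻(s), g⁺(s)]` and `[g⁻(t), g⁺(t)]` is at most `ε` whenever
`|s − t| < h`, then for every `x ∈ [a,b]` the Hausdorff distance between
`[S_{n,σ}(g⁻, x), S_{n,σ}(g⁺, x)]` and `[g⁻(x), g⁺(x)]` is at most `ε`. -/
theorem stmt5 (m : ℝ) (hm : 0 < m) (σ : ℝ → ℝ)
    (hσ_mono : Monotone σ)
    (hσ0 : ∀ x : ℝ, x ≤ -m → σ x = 0)
    (hσ1 : ∀ x : ℝ, m ≤ x → σ x = 1)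
    (a b : ℝ) (hab : a < b) (n : ℕ) (hn : 1 ≤ n)
    (glo ghi : ℝ → ℝ) (hle : ∀ t ∈ Set.Icc a b, glo t ≤ ghi t)
    (ε : ℝ) (hε : 0 ≤ ε)
    (hmod : ∀ s ∈ Set.Icc a b, ∀ t ∈ Set.Icc a b, |s - t| < (b - a) / n →
      Metric.hausdorffDist (Set.Icc (glo s) (ghi s)) (Set.Icc (glo t) (ghi t)) ≤ ε) :
    ∀ x ∈ Set.Icc a b,
      Metric.hausdorffDist (Set.Icc (NN σ m a b n glo x) (NN σ m a b n ghi x))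
        (Set.Icc (glo x) (ghi x)) ≤ ε := by
  intro x hx
  have hclose : ∀ t ∈ Set.Icc a b, |t - x| < (b - a) / n →
      |glo t - glo x| ≤ ε ∧ |ghi t - ghi x| ≤ ε := fun t ht htx =>
    abs_sub_le_of_hausdorffDist_Icc_le (hle t ht) (hle x hx) (hmod t ht x hx htx)
  exact hausdorffDist_Icc_le (NN_mono hσ_mono hm.le hab.le hn hle x) (hle x hx)
    (abs_NN_sub_le hσ_mono hm.le hσ0 hσ1 hab hn hx fun t ht htx => (hclose t ht htx).1)
    (abs_NN_sub_le hσ_mono hm.le hσ0 hσ1 hab hn hx fun t ht htx => (hclose t ht htx).2)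
end

section
/- Work in the plane ℝ² with the Euclidean distance. For t ∈ (0,1] let E_t = (ℝ × {0}) ∪ ([t,1] × [0,1]) (the endograph of the fuzzy number u_t = χ_{[t,1]}). Then for all s, t ∈ (0,1], d_H(E_t, E_s) = |t − s|. -/
/-- The endograph of the fuzzy number `u_t = χ_{[t,1]}`:
`E_t = (ℝ × {0}) ∪ ([t,1] × [0,1])` as a subset of the Euclidean plane. -/
def Endo (t : ℝ) : Set (EuclideanSpace ℝ (Fin 2)) :=
  {p | p 1 = 0} ∪ {p | p 0 ∈ Set.Icc t 1 ∧ p 1 ∈ Set.Icc (0:ℝ) 1}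

lemma Endo_anti {t s : ℝ} (hts : t ≤ s) : Endo s ⊆ Endo t := by
  rintro p (hp | ⟨⟨h₁, h₂⟩, hp⟩)
  · exact Or.inl hp
  · exact Or.inr ⟨⟨hts.trans h₁, h₂⟩, hp⟩

lemma exists_mem_Endo_dist_le {t s : ℝ} (hts : t ≤ s) (hs : s ≤ 1)
    {p : EuclideanSpace ℝ (Fin 2)} (hp : p ∈ Endo t) : ∃ q ∈ Endo s, dist p q ≤ s - t := by
  rcases hp with hp | ⟨⟨h₁, h₂⟩, hp⟩
  · exact ⟨p, Or.inl hp, by simpa using hts⟩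
  · refine ⟨!₂[max (p 0) s, p 1], Or.inr ⟨⟨by simp, by simp [h₂, hs]⟩, by simpa using hp⟩, ?_⟩
    rw [EuclideanSpace.dist_eq, Fin.sum_univ_two]
    simp only [Matrix.cons_val_zero, Matrix.cons_val_one, dist_self, ne_eq, OfNat.ofNat_ne_zero,
      not_false_eq_true, zero_pow, add_zero, Real.dist_eq]
    rw [Real.sqrt_sq (abs_nonneg _), abs_le]
    rcases max_cases (p 0) s with ⟨h, _⟩ | ⟨h, _⟩ <;> rw [h] <;> constructor <;> linarith

lemma hausdorffEDist_Endo_le {t s : ℝ} (hts : t ≤ s) (hs : s ≤ 1) :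
    Metric.hausdorffEDist (Endo t) (Endo s) ≤ ENNReal.ofReal (s - t) := by
  refine Metric.hausdorffEDist_le_of_mem_edist (fun p hp => ?_) fun p hp => ?_
  · obtain ⟨q, hq, h⟩ := exists_mem_Endo_dist_le hts hs hp
    exact ⟨q, hq, by rw [edist_dist]; exact ENNReal.ofReal_le_ofReal h⟩
  · exact ⟨p, Endo_anti hts hp, by simp⟩

lemma le_dist_of_mem_Endo {t s : ℝ} (ht : 0 ≤ t) (hs : s ≤ 1)
    {q : EuclideanSpace ℝ (Fin 2)} (hq : q ∈ Endo s) : s - t ≤ dist !₂[t, 1] q := by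
  have coord (i : Fin 2) : |!₂[t, 1] i - q i| ≤ dist !₂[t, 1] q := by
    rw [dist_eq_norm]
    exact PiLp.norm_apply_le (!₂[t, 1] - q) i
  rcases hq with hq | ⟨⟨h, _⟩, _⟩
  · have h₁ := coord 1
    have hq' : q 1 = 0 := hq
    simp [hq'] at h₁
    linarith
  · have h₀ := (abs_le.mp (coord 0)).1
    simp at h₀
    linarith

lemma hausdorffDist_Endo_of_le {t s : ℝ} (ht : 0 ≤ t) (hts : t ≤ s) (hs : s ≤ 1) :
    Metric.hausdorffDist (Endo t) (Endo s) = s - t := by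
  have hle := hausdorffEDist_Endo_le hts hs
  refine le_antisymm (ENNReal.toReal_le_of_le_ofReal (sub_nonneg.mpr hts) hle) ?_
  by_contra! hlt
  have hmem : !₂[t, 1] ∈ Endo t := Or.inr ⟨⟨by simp, by simpa using hts.trans hs⟩, by simp⟩
  obtain ⟨q, hq, h⟩ := Metric.exists_dist_lt_of_hausdorffDist_lt hmem hlt
    (ne_top_of_le_ne_top ENNReal.ofReal_ne_top hle)
  exact h.not_ge (le_dist_of_mem_Endo ht hs hq)

/-- For all `s, t ∈ (0,1]`, `d_H(E_t, E_s) = |t − s|`. -/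
theorem stmt19 :
    ∀ s ∈ Set.Ioc (0:ℝ) 1, ∀ t ∈ Set.Ioc (0:ℝ) 1,
      Metric.hausdorffDist (Endo t) (Endo s) = |t - s| := by
  rintro s ⟨hs₀, hs₁⟩ t ⟨ht₀, ht₁⟩
  rcases le_total t s with h | h
  · rw [hausdorffDist_Endo_of_le ht₀.le h hs₁, abs_sub_comm, abs_of_nonneg (sub_nonneg.mpr h)]
  · rw [Metric.hausdorffDist_comm, hausdorffDist_Endo_of_le hs₀.le h ht₁,
      abs_of_nonneg (sub_nonneg.mpr h)]
end
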